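/- arXiv:2402.13366 — 3 statements merged into one kernel-verified Lean document; each statement's English description precedes it below -/
import Mathlib

section
/- Let Y(1), …, Y(K) be i.i.d. samples from Y = θ + ε with θ ∈ ℝ^d and ε ~ N(0, Σ) for a positive definite d×d matrix Σ, and define ς² := Tr(Σ)/d and the estimator ς̂²(K) := (1/(d(K−1)))·Σ_{i=1}^K ‖Y(i) − (1/K)·Σ_{i'=1}^K Y(i')‖². Then with probability at least 1 − 2·exp(−[(K−1)/24 − log d]), it holds that (1/2)·ς² ≤ ς̂²(K) ≤ (3/2)·ς². -/
open MeasureTheory ProbabilityTheory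

lemma integrable_exp_mul_sq_gaussianReal {t : ℝ} (ht : t < 1 / 2) :
    Integrable (fun x : ℝ => Real.exp (t * x ^ 2)) (gaussianReal 0 1) := by
  rw [gaussianReal_of_var_ne_zero _ one_ne_zero,
    integrable_withDensity_iff_integrable_smul' (measurable_gaussianPDF _ _)
      (ae_of_all _ fun _ => gaussianPDF_lt_top)]
  have hb : 0 < 1 / 2 - t := by linarith
  refine ((integrable_exp_neg_mul_sq hb).const_mul (√(2 * Real.pi))⁻¹).congr
    (ae_of_all _ fun x => ?_)
  simp only [toReal_gaussianPDF, gaussianPDFReal, smul_eq_mul, NNReal.coe_one, mul_one, sub_zero]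
  rw [mul_assoc, ← Real.exp_add]
  ring_nf

lemma mgf_sq_gaussianReal {t : ℝ} (ht : t < 1 / 2) :
    mgf (fun x : ℝ => x ^ 2) (gaussianReal 0 1) t = (√(1 - 2 * t))⁻¹ := by
  have hb : 0 < 1 / 2 - t := by linarith
  have h (x : ℝ) : gaussianPDFReal 0 1 x • Real.exp (t * x ^ 2) =
      (√(2 * Real.pi))⁻¹ * Real.exp (-(1 / 2 - t) * x ^ 2) := by
    simp only [gaussianPDFReal, smul_eq_mul, NNReal.coe_one, mul_one, sub_zero]
    rw [mul_assoc, ← Real.exp_add]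
    ring_nf
  rw [mgf, integral_gaussianReal_eq_integral_smul one_ne_zero]
  simp_rw [h]
  rw [integral_const_mul, integral_gaussian, ← Real.sqrt_inv, ← Real.sqrt_inv,
    ← Real.sqrt_mul (by positivity)]
  congr 1
  have : 1 - 2 * t ≠ 0 := by linarith
  have := Real.pi_ne_zero
  field_simp

/-- The standard Gaussian measure on `ι → ℝ` is preserved by a linear isometry of the Euclidean
norm which sends the `i₀`-th basis vector to a prescribed unit vector. -/
lemma exists_measurePreserving_pi_gaussianReal_sum_mul {ι : Type*} [Fintype ι] (u : ι → ℝ)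
    (hu : ∑ i, u i ^ 2 = 1) (i₀ : ι) :
    ∃ R : (ι → ℝ) → ι → ℝ,
      MeasurePreserving R (Measure.pi fun _ => gaussianReal 0 1)
        (Measure.pi fun _ => gaussianReal 0 1) ∧
      (∀ x, ∑ i, u i * R x i = x i₀) ∧ ∀ x, ∑ i, R x i ^ 2 = ∑ i, x i ^ 2 := by
  classical
  have hu1 : ‖WithLp.toLp 2 u‖ = 1 := by simp [EuclideanSpace.norm_eq, hu]
  obtain ⟨b, hb⟩ := Orthonormal.exists_orthonormalBasis_extension_of_card_eq
    (𝕜 := ℝ) (E := EuclideanSpace ℝ ι) (ι := ι) (by simp)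
    (v := fun _ => WithLp.toLp 2 u) (s := {i₀}) (by
      rw [orthonormal_iff_ite]
      rintro ⟨i, rfl⟩ ⟨j, rfl⟩
      simp [hu1])
  have hb0 : b i₀ = WithLp.toLp 2 u := hb i₀ rfl
  have hmeas : Measurable fun x : ι → ℝ => ∑ i, x i • b i := by fun_prop
  have hmeas' : Measurable (WithLp.ofLp : EuclideanSpace ℝ ι → ι → ℝ) := by fun_prop
  refine ⟨fun x => WithLp.ofLp (∑ i, x i • b i), ⟨hmeas'.comp hmeas, ?_⟩, fun x => ?_, fun x => ?_⟩
  · change Measure.map (WithLp.ofLp ∘ fun x : ι → ℝ => ∑ i, x i • b i) _ = _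
    rw [← Measure.map_map hmeas' hmeas, ← stdGaussian_eq_map_pi_orthonormalBasis b,
      ← map_pi_eq_stdGaussian, Measure.map_map hmeas' (by fun_prop)]
    exact Measure.map_id
  · have h : inner ℝ (b i₀) (∑ i, x i • b i) = x i₀ := b.orthonormal.inner_right_fintype x i₀
    rw [← h, hb0, PiLp.inner_apply]
    simp [mul_comm]
  · have h : ∑ i, x i • b i = b.repr.symm (WithLp.toLp 2 x) := by
      simpa using (b.sum_repr_symm (WithLp.toLp 2 x))
    simp only [h]
    rw [← EuclideanSpace.real_norm_sq_eq, LinearIsometryEquiv.norm_map,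
      EuclideanSpace.real_norm_sq_eq]

lemma measurePreserving_sum_mul_pi_gaussianReal {ι : Type*} [Fintype ι] (u : ι → ℝ)
    (hu : ∑ i, u i ^ 2 = 1) :
    MeasurePreserving (fun x : ι → ℝ => ∑ i, u i * x i) (Measure.pi fun _ => gaussianReal 0 1)
      (gaussianReal 0 1) := by
  obtain ⟨i₀⟩ : Nonempty ι := by
    by_contra h
    rw [not_nonempty_iff] at h
    simp at hu
  obtain ⟨R, hR, hRu, -⟩ := exists_measurePreserving_pi_gaussianReal_sum_mul u hu i₀
  have hm : Measurable fun x : ι → ℝ => ∑ i, u i * x i := by fun_prop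
  refine ⟨hm, ?_⟩
  have h := (measurePreserving_eval (fun _ : ι => gaussianReal 0 1) i₀).map_eq
  conv_lhs => rw [← hR.map_eq]
  rw [Measure.map_map hm hR.measurable]
  exact (congrArg (fun f => Measure.map f _) (funext hRu)).trans h

section ChiSquared

variable {ι : Type*} [Fintype ι]

lemma integrable_exp_mul_sum_sq_pi_gaussianReal (s : Finset ι) {t : ℝ} (ht : t < 1 / 2) :
    Integrable (fun x : ι → ℝ => Real.exp (t * (∑ i ∈ s, fun x : ι → ℝ => x i ^ 2) x))
      (Measure.pi fun _ => gaussianReal 0 1) := by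
  have hind : iIndepFun (fun i (x : ι → ℝ) => x i ^ 2) (Measure.pi fun _ => gaussianReal 0 1) :=
    iIndepFun_pi (X := fun _ (x : ℝ) => x ^ 2) fun _ => by fun_prop
  refine hind.integrable_exp_mul_sum (fun i => by fun_prop) fun i _ => ?_
  exact (measurePreserving_eval (fun _ : ι => gaussianReal 0 1) i).integrable_comp_of_integrable
    (integrable_exp_mul_sq_gaussianReal ht)

lemma mgf_sum_sq_pi_gaussianReal (s : Finset ι) {t : ℝ} (ht : t < 1 / 2) :
    mgf (∑ i ∈ s, fun x : ι → ℝ => x i ^ 2) (Measure.pi fun _ => gaussianReal 0 1) t =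
      (√(1 - 2 * t))⁻¹ ^ s.card := by
  have hind : iIndepFun (fun i (x : ι → ℝ) => x i ^ 2) (Measure.pi fun _ => gaussianReal 0 1) :=
    iIndepFun_pi (X := fun _ (x : ℝ) => x ^ 2) fun _ => by fun_prop
  rw [hind.mgf_sum (fun i => by fun_prop), Finset.prod_congr rfl, Finset.prod_const]
  intro i _
  have h := measurePreserving_eval (fun _ : ι => gaussianReal 0 1) i
  rw [← mgf_sq_gaussianReal ht]
  conv_rhs => rw [← h.map_eq]
  rw [mgf_map h.measurable.aemeasurable (by fun_prop)]
  rfl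

lemma measureReal_three_halves_mul_card_le_sum_sq (s : Finset ι) :
    (Measure.pi fun _ : ι => gaussianReal 0 1).real
      {x | 3 / 2 * (s.card : ℝ) ≤ ∑ i ∈ s, x i ^ 2} ≤ Real.exp (-(s.card / 24)) := by
  have h := measure_ge_le_exp_mul_mgf (3 / 2 * (s.card : ℝ)) (by norm_num : (0 : ℝ) ≤ 1 / 6)
    (integrable_exp_mul_sum_sq_pi_gaussianReal s (by norm_num))
  rw [mgf_sum_sq_pi_gaussianReal s (by norm_num)] at h
  simp only [Finset.sum_apply] at h
  have hs : (√(1 - 2 * (1 / 6)))⁻¹ ≤ Real.exp (5 / 24) := by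
    rw [← Real.sqrt_inv, Real.sqrt_le_left (Real.exp_pos _).le, ← Real.exp_nat_mul]
    refine le_trans ?_ (Real.sum_le_exp_of_nonneg (by norm_num) 4)
    norm_num [Finset.sum_range_succ, Nat.factorial]
  calc _ ≤ _ := h
    _ ≤ Real.exp (-(1 / 6) * (3 / 2 * s.card)) * Real.exp (5 / 24) ^ s.card := by gcongr
    _ = _ := by rw [← Real.exp_nat_mul, ← Real.exp_add]; ring_nf

lemma measureReal_sum_sq_le_half_mul_card (s : Finset ι) :
    (Measure.pi fun _ : ι => gaussianReal 0 1).real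
      {x | ∑ i ∈ s, x i ^ 2 ≤ 1 / 2 * (s.card : ℝ)} ≤ Real.exp (-(s.card / 24)) := by
  have h := measure_le_le_exp_mul_mgf (1 / 2 * (s.card : ℝ)) (by norm_num : (-1 / 2 : ℝ) ≤ 0)
    (integrable_exp_mul_sum_sq_pi_gaussianReal s (by norm_num))
  rw [mgf_sum_sq_pi_gaussianReal s (by norm_num)] at h
  simp only [Finset.sum_apply] at h
  have hs : (√(1 - 2 * (-1 / 2)))⁻¹ ≤ Real.exp (-7 / 24) := by
    rw [← Real.sqrt_inv, Real.sqrt_le_left (Real.exp_pos _).le, ← Real.exp_nat_mul,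
      ← Real.log_le_iff_le_exp (by norm_num), Real.log_inv]
    have := Real.log_two_gt_d9
    norm_num at this ⊢
    linarith
  calc _ ≤ _ := h
    _ ≤ Real.exp (-(-1 / 2) * (1 / 2 * s.card)) * Real.exp (-7 / 24) ^ s.card := by gcongr
    _ = _ := by rw [← Real.exp_nat_mul, ← Real.exp_add]; ring_nf

end ChiSquared

lemma sum_sub_mean_sq {K : ℕ} (hK : K ≠ 0) (x : Fin K → ℝ) :
    ∑ k, (x k - (∑ k', x k') / K) ^ 2 = ∑ k, x k ^ 2 - (∑ k, (√K)⁻¹ * x k) ^ 2 := by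
  have hK' : (K : ℝ) ≠ 0 := by exact_mod_cast hK
  have h (m : ℝ) : ∑ k, (x k - m) ^ 2 = ∑ k, x k ^ 2 - 2 * m * ∑ k, x k + K * m ^ 2 := by
    have hk (k : Fin K) : (x k - m) ^ 2 = x k ^ 2 - 2 * m * x k + m ^ 2 := by ring
    simp_rw [hk, Finset.sum_add_distrib, Finset.sum_sub_distrib, ← Finset.mul_sum]
    simp
  rw [h, ← Finset.mul_sum, mul_pow, inv_pow, Real.sq_sqrt (Nat.cast_nonneg K)]
  field_simp
  ring

lemma measurableSet_le_or_ge {α : Type*} [MeasurableSpace α] {f : α → ℝ} (hf : Measurable f)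
    (a b : ℝ) : MeasurableSet {x | f x ≤ a ∨ b ≤ f x} :=
  (measurableSet_le hf measurable_const).union (measurableSet_le measurable_const hf)

/-- Two-sided concentration of the unnormalized sample variance of `K` standard Gaussians. -/
lemma measureReal_sum_sub_mean_sq {K : ℕ} (hK : 1 ≤ K) :
    (Measure.pi fun _ : Fin K => gaussianReal 0 1).real
      {x | ∑ k, (x k - (∑ k', x k') / K) ^ 2 ≤ 1 / 2 * ((K : ℝ) - 1) ∨
        3 / 2 * ((K : ℝ) - 1) ≤ ∑ k, (x k - (∑ k', x k') / K) ^ 2} ≤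
      2 * Real.exp (-(((K : ℝ) - 1) / 24)) := by
  have hK0 : K ≠ 0 := by lia
  have hKr : (K : ℝ) ≠ 0 := by exact_mod_cast hK0
  let i₀ : Fin K := ⟨0, hK⟩
  obtain ⟨R, hR, hRu, hRn⟩ := exists_measurePreserving_pi_gaussianReal_sum_mul
    (fun _ : Fin K => (√K)⁻¹) (by simp [hKr]) i₀
  have hQ (x : Fin K → ℝ) : ∑ k, (R x k - (∑ k', R x k') / K) ^ 2 =
      ∑ k ∈ Finset.univ.erase i₀, x k ^ 2 := by
    rw [sum_sub_mean_sq hK0, hRu, hRn, ← Finset.add_sum_erase _ _ (Finset.mem_univ i₀)]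
    ring
  have hc : ((Finset.univ.erase i₀).card : ℝ) = K - 1 := by
    simp [Finset.card_erase_of_mem, Nat.cast_sub hK]
  have h1 := measureReal_three_halves_mul_card_le_sum_sq (Finset.univ.erase i₀)
  have h2 := measureReal_sum_sq_le_half_mul_card (Finset.univ.erase i₀)
  rw [hc] at h1 h2
  rw [← hR.measureReal_preimage (MeasurableSet.nullMeasurableSet
    (measurableSet_le_or_ge (by fun_prop) _ _))]
  simp only [Set.preimage_ofPred_eq, hQ]
  exact (measureReal_union_le _ _).trans ((add_le_add h2 h1).trans_eq (two_mul _).symm)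

/-- Concentration of the sample variance of a linear functional of standard Gaussian vectors. -/
lemma measureReal_sum_sub_mean_sq_linear {d K : ℕ} (hK : 1 ≤ K) (c : ℝ) (a : Fin d → ℝ)
    (ha : 0 < ∑ j, a j ^ 2) :
    (Measure.pi fun _ : Fin K => Measure.pi fun _ : Fin d => gaussianReal 0 1).real
      {z | ∑ k, (c + ∑ j, a j * z k j - (∑ k', (c + ∑ j, a j * z k' j)) / K) ^ 2 ≤
          1 / 2 * ((K : ℝ) - 1) * ∑ j, a j ^ 2 ∨
        3 / 2 * ((K : ℝ) - 1) * ∑ j, a j ^ 2 ≤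
          ∑ k, (c + ∑ j, a j * z k j - (∑ k', (c + ∑ j, a j * z k' j)) / K) ^ 2} ≤
      2 * Real.exp (-(((K : ℝ) - 1) / 24)) := by
  have hKr : (K : ℝ) ≠ 0 := by exact_mod_cast (by lia : K ≠ 0)
  set v := ∑ j, a j ^ 2
  have hP : MeasurePreserving
      (fun (z : Fin K → Fin d → ℝ) k => ∑ j, a j / √v * z k j)
      (Measure.pi fun _ : Fin K => Measure.pi fun _ : Fin d => gaussianReal 0 1)
      (Measure.pi fun _ : Fin K => gaussianReal 0 1) :=
    measurePreserving_pi _ _ fun _ => measurePreserving_sum_mul_pi_gaussianReal _ (by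
      simp_rw [div_pow, Real.sq_sqrt ha.le, ← Finset.sum_div]
      exact div_self ha.ne')
  have h := measureReal_sum_sub_mean_sq hK
  rw [← hP.measureReal_preimage (MeasurableSet.nullMeasurableSet
    (measurableSet_le_or_ge (by fun_prop) _ _))] at h
  have hQ (z : Fin K → Fin d → ℝ) :
      ∑ k, (c + ∑ j, a j * z k j - (∑ k', (c + ∑ j, a j * z k' j)) / K) ^ 2 =
        (∑ k, (∑ j, a j / √v * z k j - (∑ k', ∑ j, a j / √v * z k' j) / K) ^ 2) * v := by
    simp_rw [div_mul_eq_mul_div, ← Finset.sum_div, Finset.sum_mul]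
    refine Finset.sum_congr rfl fun k _ => ?_
    rw [div_right_comm, ← sub_div, div_pow, Real.sq_sqrt ha.le, div_mul_cancel₀ _ ha.ne',
      Finset.sum_add_distrib]
    simp only [Finset.sum_const, Finset.card_univ, Fintype.card_fin, nsmul_eq_mul]
    field_simp
    ring
  simp only [Set.preimage_ofPred_eq] at h
  simp only [hQ, mul_le_mul_iff_left₀ ha]
  exact h

/-- **Multiplicative concentration of the normalized-trace estimator** (general noise
covariance).  For `K` i.i.d. samples from `Y = θ + ε`, `ε ~ N(0, Σ)` with `Σ` positive
definite (realized via `ε = A z`, `A Aᵀ = Σ`, `z` standard Gaussian), the estimator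
`ς̂²(K) = (1/(d(K−1)))·∑_k ‖Y(k) − Ȳ‖²` of `ς² = Tr(Σ)/d` satisfies
`ς²/2 ≤ ς̂²(K) ≤ 3ς²/2` with probability at least `1 − 2·exp(−[(K−1)/24 − log d])`. -/
theorem sample_trace_concentration (d K : ℕ) (hd : 0 < d) (hK : 2 ≤ K)
    (θ : Fin d → ℝ) (Sig A : Matrix (Fin d) (Fin d) ℝ)
    (hSig : Sig.PosDef) (hA : A * A.transpose = Sig) :
    ((Measure.pi fun _ : Fin K => Measure.pi fun _ : Fin d => gaussianReal 0 1).map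
        (fun z => fun k => fun i => θ i + A.mulVec (z k) i))
      {y : Fin K → Fin d → ℝ |
        1 / 2 * (Sig.trace / d) ≤
            1 / (d * ((K : ℝ) - 1)) * ∑ k, ∑ i, (y k i - (∑ k', y k' i) / K) ^ 2 ∧
        1 / (d * ((K : ℝ) - 1)) * ∑ k, ∑ i, (y k i - (∑ k', y k' i) / K) ^ 2 ≤
            3 / 2 * (Sig.trace / d)}
      ≥ ENNReal.ofReal (1 - 2 * Real.exp (-(((K : ℝ) - 1) / 24 - Real.log d))) := by
  have hK1 : (0 : ℝ) < K - 1 := by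
    have : (2 : ℝ) ≤ K := by exact_mod_cast hK
    linarith
  have hd' : (0 : ℝ) < d := by exact_mod_cast hd
  have hdiag (i : Fin d) : ∑ j, A i j ^ 2 = Sig i i := by
    simp [← hA, Matrix.mul_apply, sq]
  have htr : Sig.trace = ∑ i, ∑ j, A i j ^ 2 := by simp [hdiag, Matrix.trace]
  have hmeas : Measurable fun (z : Fin K → Fin d → ℝ) k i => θ i + A.mulVec (z k) i := by
    simp only [Matrix.mulVec, dotProduct]
    fun_prop
  refine le_trans ?_ (Measure.le_map_apply hmeas.aemeasurable _)
  set μ := Measure.pi fun _ : Fin K => Measure.pi fun _ : Fin d => gaussianReal 0 1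
  let S (i : Fin d) (z : Fin K → Fin d → ℝ) : ℝ :=
    ∑ k, (θ i + ∑ j, A i j * z k j - (∑ k', (θ i + ∑ j, A i j * z k' j)) / K) ^ 2
  let bad (i : Fin d) : Set (Fin K → Fin d → ℝ) :=
    {z | S i z ≤ 1 / 2 * ((K : ℝ) - 1) * ∑ j, A i j ^ 2 ∨
      3 / 2 * ((K : ℝ) - 1) * ∑ j, A i j ^ 2 ≤ S i z}
  have hbad (i : Fin d) : μ.real (bad i) ≤ 2 * Real.exp (-(((K : ℝ) - 1) / 24)) :=
    measureReal_sum_sub_mean_sq_linear (by lia) (θ i) (A i) (by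
      rw [hdiag]
      exact hSig.diag_pos)
  set good := (fun (z : Fin K → Fin d → ℝ) k i => θ i + A.mulVec (z k) i) ⁻¹'
      {y : Fin K → Fin d → ℝ |
        1 / 2 * (Sig.trace / d) ≤
            1 / (d * ((K : ℝ) - 1)) * ∑ k, ∑ i, (y k i - (∑ k', y k' i) / K) ^ 2 ∧
        1 / (d * ((K : ℝ) - 1)) * ∑ k, ∑ i, (y k i - (∑ k', y k' i) / K) ^ 2 ≤
            3 / 2 * (Sig.trace / d)} with hgood
  have hcover : Set.univ ⊆ good ∪ ⋃ i, bad i := by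
    intro z _
    by_cases hz : ∃ i, z ∈ bad i
    · exact Or.inr (Set.mem_iUnion.2 hz)
    refine Or.inl ?_
    simp only [bad, Set.mem_ofPred_eq, not_exists, not_or, not_le] at hz
    have hlow := Finset.sum_le_sum fun i (_ : i ∈ Finset.univ) => (hz i).1.le
    have hupp := Finset.sum_le_sum fun i (_ : i ∈ Finset.univ) => (hz i).2.le
    rw [← Finset.mul_sum, ← htr] at hlow hupp
    simp only [hgood, Set.mem_preimage, Set.mem_ofPred_eq, Matrix.mulVec, dotProduct]
    rw [Finset.sum_comm]
    change _ ≤ _ * ∑ i, S i z ∧ _ * ∑ i, S i z ≤ _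
    rw [one_div_mul_eq_div (d * ((K : ℝ) - 1)), ← mul_div_assoc, ← mul_div_assoc,
      div_le_div_iff₀ hd' (by positivity), div_le_div_iff₀ (by positivity) hd']
    constructor <;> nlinarith
  have hone : 1 ≤ μ.real good + d * (2 * Real.exp (-(((K : ℝ) - 1) / 24))) :=
    calc (1 : ℝ) = μ.real Set.univ := by simp
      _ ≤ μ.real (good ∪ ⋃ i, bad i) := measureReal_mono hcover
      _ ≤ μ.real good + ∑ i, μ.real (bad i) :=
        (measureReal_union_le _ _).trans (by gcongr; exact measureReal_iUnion_fintype_le _)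
      _ ≤ μ.real good + ∑ i : Fin d, 2 * Real.exp (-(((K : ℝ) - 1) / 24)) := by
        gcongr with i
        exact hbad i
      _ = _ := by simp
  refine ENNReal.ofReal_le_of_le_toReal ?_
  change _ ≤ μ.real good
  rw [neg_sub, sub_eq_add_neg (Real.log d), Real.exp_add, Real.exp_log hd']
  linarith
end

section
/- Assume d ≥ 3, let σ, σ' > 0 with σ'² ≥ σ², and let {v^(1), …, v^(K)} ⊂ ℝ^d be a set of unit vectors with zero first coordinate, pairwise Euclidean distances at least c(d) = e^{−(d+2)/(d−2)}, and cardinality K ≥ 4·e^d. Define the parameter set Θ := { √(dσ²/N)·v^(j) : j ∈ [K] }. Then for every estimator θ̂ that is a measurable function of N i.i.d. samples from N(θ, σ'²·I_d), the worst case over θ ∈ Θ of E[‖θ̂ − θ‖²] is at least (c²(d)/2)·(dσ²/N). -/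
open MeasureTheory ProbabilityTheory

/-- Squared Euclidean distance on `Fin d → ℝ`. -/
noncomputable def sqDist {d : ℕ} (x y : Fin d → ℝ) : ℝ := ∑ i, (x i - y i) ^ 2

open scoped NNReal ENNReal

theorem lintegral_pi_prod {ι : Type*} [Fintype ι] {E : ι → Type*} {mE : ∀ i, MeasurableSpace (E i)}
    {μ : ∀ i, Measure (E i)} [∀ i, IsProbabilityMeasure (μ i)] {f : ∀ i, E i → ℝ≥0∞}
    (hf : ∀ i, Measurable (f i)) :
    ∫⁻ x, ∏ i, f i (x i) ∂Measure.pi μ = ∏ i, ∫⁻ x, f i x ∂μ i := by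
  refine (lintegral_prod_eq_prod_lintegral_of_indepFun Finset.univ
    (fun i (x : ∀ i, E i) ↦ f i (x i)) (iIndepFun_pi fun i ↦ (hf i).aemeasurable)
    fun i ↦ (hf i).comp (measurable_pi_apply i)).trans ?_
  refine Finset.prod_congr rfl fun i _ ↦ ?_
  rw [← (measurePreserving_eval μ i).lintegral_comp (hf i)]

theorem pi_withDensity {ι : Type*} [Fintype ι] {E : ι → Type*} {mE : ∀ i, MeasurableSpace (E i)}
    {μ : ∀ i, Measure (E i)} [∀ i, IsProbabilityMeasure (μ i)] {f : ∀ i, E i → ℝ≥0∞}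
    (hf : ∀ i, Measurable (f i)) [∀ i, SigmaFinite ((μ i).withDensity (f i))] :
    Measure.pi (fun i ↦ (μ i).withDensity (f i)) =
      (Measure.pi μ).withDensity fun x ↦ ∏ i, f i (x i) := by
  refine Measure.pi_eq fun s hs ↦ ?_
  rw [withDensity_apply _ (.univ_pi hs), ← lintegral_indicator (.univ_pi hs)]
  have h : ∀ x, (Set.univ.pi s).indicator (fun x ↦ ∏ i, f i (x i)) x =
      ∏ i, (s i).indicator (f i) (x i) := by
    intro x
    classical
    by_cases hx : ∀ i, x i ∈ s i
    · rw [Set.indicator_of_mem (by simpa [Set.mem_pi] using hx)]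
      exact Finset.prod_congr rfl fun i _ ↦ (Set.indicator_of_mem (hx i) _).symm
    · rw [Set.indicator_of_notMem (by simpa [Set.mem_pi] using hx)]
      obtain ⟨i, hi⟩ := not_forall.mp hx
      exact (Finset.prod_eq_zero (Finset.mem_univ i) (Set.indicator_of_notMem hi _)).symm
  simp_rw [h]
  rw [lintegral_pi_prod fun i ↦ (hf i).indicator (hs i)]
  refine Finset.prod_congr rfl fun i _ ↦ ?_
  rw [lintegral_indicator (hs i), withDensity_apply _ (hs i)]

theorem gaussianReal_eq_withDensity (m : ℝ) {V : ℝ≥0} (hV : V ≠ 0) :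
    gaussianReal m V = (gaussianReal 0 V).withDensity
      fun y ↦ ENNReal.ofReal (Real.exp (m * y / V - m ^ 2 / (2 * V))) := by
  have hV' : (V : ℝ) ≠ 0 := by exact_mod_cast hV
  rw [gaussianReal_of_var_ne_zero _ hV, gaussianReal_of_var_ne_zero _ hV,
    ← withDensity_mul _ (measurable_gaussianPDF _ _) (by fun_prop)]
  congr 1
  ext y
  simp only [gaussianPDF, Pi.mul_apply, gaussianPDFReal]
  rw [← ENNReal.ofReal_mul (by positivity), mul_assoc _ (Real.exp _), ← Real.exp_add]
  congr 3
  field_simp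
  ring

theorem pi_gaussianReal_eq_withDensity {ι : Type*} [Fintype ι] (m : ι → ℝ) {V : ℝ≥0}
    (hV : V ≠ 0) :
    Measure.pi (fun i ↦ gaussianReal (m i) V) =
      (Measure.pi fun _ : ι ↦ gaussianReal 0 V).withDensity
        fun y ↦ ENNReal.ofReal (Real.exp (∑ i, (m i * y i / V - m i ^ 2 / (2 * V)))) := by
  have h (i : ι) : SigmaFinite ((gaussianReal 0 V).withDensity
      fun y ↦ ENNReal.ofReal (Real.exp (m i * y / V - m i ^ 2 / (2 * V)))) := by
    rw [← gaussianReal_eq_withDensity _ hV]; infer_instance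
  simp_rw [fun i ↦ gaussianReal_eq_withDensity (m i) hV]
  rw [pi_withDensity fun i ↦ by fun_prop]
  simp_rw [Real.exp_sum, ENNReal.ofReal_prod_of_nonneg fun i _ ↦ (Real.exp_pos _).le]

theorem pi_pi_gaussianReal_eq_withDensity {κ ι : Type*} [Fintype κ] [Fintype ι] (m : ι → ℝ)
    {V : ℝ≥0} (hV : V ≠ 0) :
    Measure.pi (fun _ : κ ↦ Measure.pi fun i ↦ gaussianReal (m i) V) =
      (Measure.pi fun _ : κ ↦ Measure.pi fun _ : ι ↦ gaussianReal 0 V).withDensity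
        fun y ↦ ENNReal.ofReal
          (Real.exp (∑ k, ∑ i, (m i * y k i / V - m i ^ 2 / (2 * V)))) := by
  have h : SigmaFinite ((Measure.pi fun _ : ι ↦ gaussianReal 0 V).withDensity
      fun y ↦ ENNReal.ofReal (Real.exp (∑ i, (m i * y i / V - m i ^ 2 / (2 * V))))) := by
    rw [← pi_gaussianReal_eq_withDensity _ hV]; infer_instance
  simp_rw [pi_gaussianReal_eq_withDensity m hV]
  rw [pi_withDensity fun i ↦ by fun_prop]
  simp_rw [Real.exp_sum _ (fun k ↦ ∑ i, _),
    ENNReal.ofReal_prod_of_nonneg fun i _ ↦ (Real.exp_pos _).le]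

theorem pi_gaussianReal_prod_map_add {ι : Type*} [Fintype ι] (m m' : ι → ℝ) (V V' : ℝ≥0) :
    ((Measure.pi fun i ↦ gaussianReal (m i) V).prod
      (Measure.pi fun i ↦ gaussianReal (m' i) V')).map (fun p ↦ p.1 + p.2) =
      Measure.pi fun i ↦ gaussianReal (m i + m' i) (V + V') := by
  rw [← (measurePreserving_arrowProdEquivProdArrow ℝ ℝ ι _ _).map_eq,
    Measure.map_map (by fun_prop) (MeasurableEquiv.measurable _)]
  have h : ((fun p : (ι → ℝ) × (ι → ℝ) ↦ p.1 + p.2) ∘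
      MeasurableEquiv.arrowProdEquivProdArrow ℝ ℝ ι) = fun x i ↦ (x i).1 + (x i).2 := rfl
  have h' (i : ι) : ((gaussianReal (m i) V).prod (gaussianReal (m' i) V')).map
      (fun p ↦ p.1 + p.2) = gaussianReal (m i + m' i) (V + V') :=
    gaussianReal_conv_gaussianReal
  have hs (i : ι) : SigmaFinite (((gaussianReal (m i) V).prod (gaussianReal (m' i) V')).map
      (fun p ↦ p.1 + p.2)) := by rw [h']; infer_instance
  rw [h, Measure.pi_map_pi (f := fun _ (p : ℝ × ℝ) ↦ p.1 + p.2) fun i ↦ by fun_prop]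
  simp_rw [h']

theorem pi_pi_gaussianReal_map_sum {ι : Type*} [Fintype ι] (N : ℕ) (m : ι → ℝ) (V : ℝ≥0) :
    (Measure.pi fun _ : Fin N ↦ Measure.pi fun i ↦ gaussianReal (m i) V).map
      (fun y ↦ ∑ k, y k) = Measure.pi fun i ↦ gaussianReal (N * m i) (N * V) := by
  induction N with
  | zero =>
    simp only [Finset.univ_eq_empty, Finset.sum_empty, Measure.map_const, measure_univ, one_smul]
    simp only [Nat.cast_zero, zero_mul, gaussianReal_zero_var]
    refine (Measure.pi_eq fun s hs ↦ ?_).symm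
    simp_rw [Measure.dirac_apply' _ (MeasurableSet.univ_pi hs), Measure.dirac_apply' _ (hs _)]
    classical
    simp only [Set.indicator_apply, Set.mem_univ_pi, Pi.zero_apply, Pi.one_apply,
      Finset.prod_ite_zero, Finset.mem_univ, true_imp_iff, Finset.prod_const_one]
  | succ N ih =>
    have h := measurePreserving_piFinSuccAbove
      (fun _ : Fin (N + 1) ↦ Measure.pi fun i ↦ gaussianReal (m i) V) 0
    have hf : (fun y : Fin (N + 1) → ι → ℝ ↦ ∑ k, y k) =
        (fun p : (ι → ℝ) × (ι → ℝ) ↦ p.1 + p.2) ∘ Prod.map id (fun y : Fin N → ι → ℝ ↦ ∑ k, y k) ∘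
          MeasurableEquiv.piFinSuccAbove (fun _ : Fin (N + 1) ↦ ι → ℝ) 0 := by
      ext y i
      simp [Fin.sum_univ_succ, MeasurableEquiv.piFinSuccAbove, Fin.tail]
    have hp : Measurable fun p : (ι → ℝ) × (ι → ℝ) ↦ p.1 + p.2 := by fun_prop
    have hq : Measurable fun y : Fin N → ι → ℝ ↦ ∑ k, y k := by fun_prop
    rw [hf, ← Measure.map_map hp ((measurable_id.prodMap hq).comp (MeasurableEquiv.measurable _)),
      ← Measure.map_map (measurable_id.prodMap hq) (MeasurableEquiv.measurable _), h.map_eq,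
      ← Measure.map_prod_map _ _ measurable_id hq, ih, Measure.map_id,
      pi_gaussianReal_prod_map_add]
    congr with i
    push_cast
    congr 2 <;> ring

/-- Blichfeldt inequality: for points at pairwise squared distance at least `δ`, the caps
`max 0 (1 - 2‖x j - z‖² / δ)` sum to at most one at every `z`. -/
theorem sum_max_le_one {ι κ : Type*} [Fintype ι] [Fintype κ] {x : κ → ι → ℝ} {δ : ℝ}
    (hδ : 0 < δ) (hsep : ∀ j k, j ≠ k → δ ≤ ∑ i, (x j i - x k i) ^ 2) (z : ι → ℝ) :
    ∑ j, max 0 (1 - 2 * (∑ i, (x j i - z i) ^ 2) / δ) ≤ 1 := by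
  classical
  set T : Finset κ := {j | 0 < 1 - 2 * (∑ i, (x j i - z i) ^ 2) / δ} with hT
  have h1 : ∑ j, max 0 (1 - 2 * (∑ i, (x j i - z i) ^ 2) / δ) =
      ∑ j ∈ T, (1 - 2 * (∑ i, (x j i - z i) ^ 2) / δ) := by
    rw [hT, Finset.sum_filter]
    refine Finset.sum_congr rfl fun j _ ↦ ?_
    split_ifs with h
    · exact max_eq_right h.le
    · exact max_eq_left (not_lt.mp h)
  rcases T.eq_empty_or_nonempty with hE | hne
  · simp [h1, hE]
  have hcard : (0 : ℝ) < T.card := by exact_mod_cast hne.card_pos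
  have hlow : ((T.card : ℝ) * T.card - T.card) * δ ≤
      ∑ j ∈ T, ∑ k ∈ T, ∑ i, (x j i - x k i) ^ 2 := by
    have h2 : ∀ j ∈ T, ((T.card : ℝ) - 1) * δ ≤ ∑ k ∈ T, ∑ i, (x j i - x k i) ^ 2 := by
      intro j hj
      rw [← Finset.add_sum_erase _ _ hj]
      have h3 := Finset.card_nsmul_le_sum (T.erase j) (fun k ↦ ∑ i, (x j i - x k i) ^ 2) δ
        fun k hk ↦ hsep j k (Finset.ne_of_mem_erase hk).symm
      rw [nsmul_eq_mul, Finset.card_erase_of_mem hj, Nat.cast_sub hne.card_pos] at h3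
      simpa using h3
    have h4 := Finset.card_nsmul_le_sum T _ _ h2
    rw [nsmul_eq_mul] at h4
    linarith
  have hup : ∑ j ∈ T, ∑ k ∈ T, ∑ i, (x j i - x k i) ^ 2 ≤
      2 * T.card * ∑ j ∈ T, ∑ i, (x j i - z i) ^ 2 := by
    have h5 (i : ι) : ∑ j ∈ T, ∑ k ∈ T, (x j i - x k i) ^ 2 ≤
        2 * T.card * ∑ j ∈ T, (x j i - z i) ^ 2 := by
      have h6 : ∑ j ∈ T, ∑ k ∈ T, (x j i - x k i) ^ 2 =
          2 * T.card * ∑ j ∈ T, (x j i - z i) ^ 2 - 2 * (∑ j ∈ T, (x j i - z i)) ^ 2 := by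
        have h7 (u : κ → ℝ) : ∑ j ∈ T, ∑ k ∈ T, (u j - u k) ^ 2 =
            2 * T.card * ∑ j ∈ T, u j ^ 2 - 2 * (∑ j ∈ T, u j) ^ 2 := by
          simp_rw [sub_sq, Finset.sum_add_distrib, Finset.sum_sub_distrib, ← Finset.mul_sum,
            ← Finset.sum_mul, Finset.sum_const, nsmul_eq_mul, ← Finset.mul_sum]
          ring
        simpa using h7 fun j ↦ x j i - z i
      nlinarith [sq_nonneg (∑ j ∈ T, (x j i - z i))]
    calc ∑ j ∈ T, ∑ k ∈ T, ∑ i, (x j i - x k i) ^ 2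
        = ∑ i, ∑ j ∈ T, ∑ k ∈ T, (x j i - x k i) ^ 2 := by
          simp_rw [Finset.sum_comm (s := T) (t := Finset.univ)]
      _ ≤ ∑ i, 2 * T.card * ∑ j ∈ T, (x j i - z i) ^ 2 := Finset.sum_le_sum fun i _ ↦ h5 i
      _ = _ := by rw [← Finset.mul_sum, Finset.sum_comm]
  rw [h1, Finset.sum_sub_distrib, ← Finset.sum_div, ← Finset.mul_sum]
  simp only [Finset.sum_const, nsmul_eq_mul, mul_one]
  have h8 : ((T.card : ℝ) - 1) * δ ≤ 2 * ∑ j ∈ T, ∑ i, (x j i - z i) ^ 2 := by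
    refine le_of_mul_le_mul_left ?_ hcard
    linarith
  rw [sub_le_comm, le_div_iff₀ hδ]
  exact h8

theorem ofReal_exp_integral_le_lintegral {Ω : Type*} {mΩ : MeasurableSpace Ω} {P : Measure Ω}
    [IsProbabilityMeasure P] {f : Ω → ℝ} (hf : Integrable f P) :
    ENNReal.ofReal (Real.exp (∫ ω, f ω ∂P)) ≤ ∫⁻ ω, ENNReal.ofReal (Real.exp (f ω)) ∂P := by
  by_cases h : ∫⁻ ω, ENNReal.ofReal (Real.exp (f ω)) ∂P = ∞
  · simp [h]
  have hi : Integrable (fun ω ↦ Real.exp (f ω)) P :=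
    ⟨Real.continuous_exp.comp_aestronglyMeasurable hf.1, by
      rw [hasFiniteIntegral_iff_ofReal (.of_forall fun _ ↦ (Real.exp_pos _).le)]
      exact lt_top_iff_ne_top.mpr h⟩
  rw [← ofReal_integral_eq_lintegral_ofReal hi (.of_forall fun _ ↦ (Real.exp_pos _).le)]
  exact ENNReal.ofReal_le_ofReal (convexOn_exp.map_integral_le Real.continuous_exp.continuousOn
    isClosed_univ (by simp) hf hi)

theorem integrable_sq_gaussianReal (m : ℝ) (V : ℝ≥0) :
    Integrable (fun x ↦ x ^ 2) (gaussianReal m V) :=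
  (memLp_id_gaussianReal 2).integrable_sq

theorem integral_sq_gaussianReal (m : ℝ) (V : ℝ≥0) :
    ∫ x, x ^ 2 ∂gaussianReal m V = V + m ^ 2 := by
  have h := variance_eq_sub (memLp_id_gaussianReal (μ := m) (v := V) 2)
  simp only [variance_id_gaussianReal, Pi.pow_apply, id_eq,
    integral_id_gaussianReal] at h
  linarith

theorem lintegral_exp_sq_gaussianReal {T : ℝ≥0} (hT : T ≠ 0) :
    ∫⁻ x, ENNReal.ofReal (Real.exp (x ^ 2 / (4 * T))) ∂gaussianReal 0 T =
      ENNReal.ofReal (Real.sqrt 2) := by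
  have hT' : (0 : ℝ) < T := by positivity
  rw [gaussianReal_of_var_ne_zero _ hT, lintegral_withDensity_eq_lintegral_mul _
    (measurable_gaussianPDF _ _) (by fun_prop)]
  have h (x : ℝ) : (gaussianPDF 0 T * fun x ↦ ENNReal.ofReal (Real.exp (x ^ 2 / (4 * T)))) x =
      ENNReal.ofReal (Real.sqrt 2) * gaussianPDF 0 (2 * T) x := by
    simp only [Pi.mul_apply, gaussianPDF, gaussianPDFReal]
    rw [← ENNReal.ofReal_mul (by positivity), ← ENNReal.ofReal_mul (by positivity),
      mul_assoc _ (Real.exp _), ← Real.exp_add, ← mul_assoc (Real.sqrt 2)]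
    congr 2
    · push_cast
      rw [show 2 * Real.pi * (2 * (T : ℝ)) = 2 * (2 * Real.pi * T) by ring,
        Real.sqrt_mul zero_le_two (2 * Real.pi * T), mul_inv, mul_inv_cancel_left₀ (by positivity)]
    · push_cast
      congr 1
      field_simp
      ring
  simp_rw [h]
  rw [lintegral_const_mul _ (measurable_gaussianPDF _ _),
    lintegral_gaussianPDF_eq_one _ (by positivity), mul_one]

theorem lintegral_pi_gaussianReal_neg {ι : Type*} [Fintype ι] (V : ℝ≥0) {f : (ι → ℝ) → ℝ≥0∞}
    (hf : Measurable f) :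
    ∫⁻ u, f (-u) ∂Measure.pi (fun _ : ι ↦ gaussianReal 0 V) =
      ∫⁻ u, f u ∂Measure.pi fun _ : ι ↦ gaussianReal 0 V := by
  have h : (Measure.pi fun _ : ι ↦ gaussianReal 0 V).map (fun u ↦ -u) =
      Measure.pi fun _ : ι ↦ gaussianReal 0 V := by
    have hs : SigmaFinite ((gaussianReal 0 V).map fun x ↦ -x) := by
      rw [gaussianReal_map_neg]; infer_instance
    refine (Measure.pi_map_pi (f := fun (_ : ι) (x : ℝ) ↦ -x) fun i ↦ by fun_prop).trans ?_
    simp_rw [gaussianReal_map_neg, neg_zero]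
  conv_rhs => rw [← h]
  rw [lintegral_map hf measurable_neg]

/-- The mass of a cap under a Gaussian centred at `b` is at least `exp (-‖b‖² / (2V))` times a lower
bound for its mass under the centred Gaussian, by symmetry and `cosh ≥ 1`. -/
theorem ofReal_exp_mul_le_lintegral_max {ι : Type*} [Fintype ι] (b : ι → ℝ) {V : ℝ≥0}
    (hV : V ≠ 0) (δ : ℝ) :
    ENNReal.ofReal (Real.exp (-(∑ i, b i ^ 2) / (2 * V))) *
        ENNReal.ofReal (1 - 2 * (Fintype.card ι * V) / δ) ≤
      ∫⁻ u, ENNReal.ofReal (max 0 (1 - 2 * (∑ i, u i ^ 2) / δ))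
        ∂Measure.pi fun i ↦ gaussianReal (b i) V := by
  set γ := Measure.pi fun _ : ι ↦ gaussianReal 0 V with hγ
  set g : (ι → ℝ) → ℝ≥0∞ := fun u ↦ ENNReal.ofReal (max 0 (1 - 2 * (∑ i, u i ^ 2) / δ)) with hg
  set C := ENNReal.ofReal (Real.exp (-(∑ i, b i ^ 2) / (2 * V))) with hC
  set L : (ι → ℝ) → ℝ≥0∞ := fun u ↦
    ENNReal.ofReal (Real.exp (∑ i, (b i * u i / V - b i ^ 2 / (2 * V)))) with hL
  have hgm : Measurable g := by fun_prop
  have hLm : Measurable L := by fun_prop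
  have hLg : Measurable fun u ↦ L u * g u := hLm.mul hgm
  have hmass : ENNReal.ofReal (1 - 2 * (Fintype.card ι * V) / δ) ≤ ∫⁻ u, g u ∂γ := by
    have hsq (i : ι) : Integrable (fun u : ι → ℝ ↦ u i ^ 2) γ :=
      integrable_comp_eval (μ := fun _ : ι ↦ gaussianReal 0 V) (f := fun x : ℝ ↦ x ^ 2)
        (integrable_sq_gaussianReal 0 V)
    have hi : Integrable (fun u : ι → ℝ ↦ 1 - 2 * (∑ i, u i ^ 2) / δ) γ :=
      (integrable_const 1).sub
        (((integrable_finsetSum _ fun i _ ↦ hsq i).const_mul 2).div_const δ)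
    have he : ∫ u : ι → ℝ, (1 - 2 * (∑ i, u i ^ 2) / δ) ∂γ =
        1 - 2 * (Fintype.card ι * V) / δ := by
      rw [integral_sub (integrable_const 1)
        (((integrable_finsetSum _ fun i _ ↦ hsq i).const_mul 2).div_const δ),
        integral_div, integral_const_mul, integral_finsetSum _ fun i _ ↦ hsq i]
      have h2 (i : ι) : ∫ u : ι → ℝ, u i ^ 2 ∂γ = V := by
        rw [hγ, integral_comp_eval (μ := fun _ : ι ↦ gaussianReal 0 V) (i := i)
            (f := fun x : ℝ ↦ x ^ 2) (by fun_prop),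
          integral_sq_gaussianReal]
        simp
      simp [h2]
    have hp : Integrable (fun u : ι → ℝ ↦ max 0 (1 - 2 * (∑ i, u i ^ 2) / δ)) γ := by
      simpa only [max_comm] using hi.pos_part
    rw [hg, ← ofReal_integral_eq_lintegral_ofReal hp (.of_forall fun _ ↦ le_max_left _ _), ← he]
    exact ENNReal.ofReal_le_ofReal (integral_mono hi hp fun _ ↦ le_max_right _ _)
  have hsymm (u : ι → ℝ) : 2 * (C * g u) ≤ L u * g u + L (-u) * g (-u) := by
    have hgu : g (-u) = g u := by simp [hg]
    have hLu : 2 * C ≤ L u + L (-u) := by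
      simp only [hL, hC]
      rw [← ENNReal.ofReal_add (Real.exp_pos _).le (Real.exp_pos _).le,
        ← ENNReal.ofReal_ofNat 2, ← ENNReal.ofReal_mul (by norm_num)]
      refine ENNReal.ofReal_le_ofReal ?_
      have h1 : ∑ i, (b i * u i / V - b i ^ 2 / (2 * V)) =
          -(∑ i, b i ^ 2) / (2 * V) + ∑ i, b i * u i / V := by
        rw [Finset.sum_sub_distrib, ← Finset.sum_div _ _ (2 * (V : ℝ))]
        ring
      have h2 : ∑ i, (b i * (-u) i / V - b i ^ 2 / (2 * V)) =
          -(∑ i, b i ^ 2) / (2 * V) + -∑ i, b i * u i / V := by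
        simp only [Pi.neg_apply, mul_neg, neg_div]
        rw [Finset.sum_sub_distrib, ← Finset.sum_div _ _ (2 * (V : ℝ)), Finset.sum_neg_distrib]
        ring
      rw [h1, h2, Real.exp_add, Real.exp_add, ← mul_add, mul_comm (2 : ℝ)]
      refine mul_le_mul_of_nonneg_left ?_ (Real.exp_pos _).le
      have := Real.one_le_cosh (∑ i, b i * u i / V)
      rw [Real.cosh_eq] at this
      linarith
    rw [hgu, ← add_mul, ← mul_assoc]
    gcongr
  rw [pi_gaussianReal_eq_withDensity b hV,
    lintegral_withDensity_eq_lintegral_mul _ hLm hgm]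
  simp only [Pi.mul_apply]
  have hdouble : 2 * (C * ∫⁻ u, g u ∂γ) ≤ 2 * ∫⁻ u, L u * g u ∂γ := by
    have hneg : ∫⁻ u, L (-u) * g (-u) ∂γ = ∫⁻ u, L u * g u ∂γ :=
      lintegral_pi_gaussianReal_neg V (hLm.mul hgm)
    rw [← lintegral_const_mul _ hgm, ← lintegral_const_mul _ (hgm.const_mul C), two_mul]
    nth_rw 2 [← hneg]
    rw [← lintegral_add_left hLg]
    exact lintegral_mono hsymm
  calc C * ENNReal.ofReal (1 - 2 * (Fintype.card ι * V) / δ)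
      ≤ C * ∫⁻ u, g u ∂γ := by gcongr
    _ ≤ _ := (ENNReal.mul_le_mul_iff_right two_ne_zero ENNReal.ofNat_ne_top).mp hdouble

/-- Gaussian kernel sums over a separated family are bounded: average the Blichfeldt inequality
against the Gaussian centred at `a`. -/
theorem sum_ofReal_exp_mul_le_one {ι κ : Type*} [Fintype ι] [Fintype κ] {x : κ → ι → ℝ} {δ : ℝ}
    (hδ : 0 < δ) (hsep : ∀ j k, j ≠ k → δ ≤ ∑ i, (x j i - x k i) ^ 2) {V : ℝ≥0} (hV : V ≠ 0)
    (a : ι → ℝ) :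
    (∑ j, ENNReal.ofReal (Real.exp (-(∑ i, (x j i - a i) ^ 2) / (2 * V)))) *
      ENNReal.ofReal (1 - 2 * (Fintype.card ι * V) / δ) ≤ 1 := by
  have hshift (j : κ) : ENNReal.ofReal (Real.exp (-(∑ i, (x j i - a i) ^ 2) / (2 * V))) *
      ENNReal.ofReal (1 - 2 * (Fintype.card ι * V) / δ) ≤
      ∫⁻ z, ENNReal.ofReal (max 0 (1 - 2 * (∑ i, (x j i - z i) ^ 2) / δ))
        ∂Measure.pi fun i ↦ gaussianReal (a i) V := by
    have h := ofReal_exp_mul_le_lintegral_max (fun i ↦ a i - x j i) hV δ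
    have hs (i : ι) : SigmaFinite ((gaussianReal (a i) V).map fun y ↦ y - x j i) := by
      rw [gaussianReal_map_sub_const]; infer_instance
    have hm : (Measure.pi fun i ↦ gaussianReal (a i) V).map (fun z i ↦ z i - x j i) =
        Measure.pi fun i ↦ gaussianReal (a i - x j i) V := by
      rw [Measure.pi_map_pi (f := fun i y ↦ y - x j i) fun i ↦ by fun_prop]
      simp_rw [gaussianReal_map_sub_const]
    rw [← hm, lintegral_map (by fun_prop) (by fun_prop)] at h
    simpa only [sub_sq_comm (a _) (x j _), sub_sq_comm _ (x j _)] using h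
  rw [Finset.sum_mul]
  calc _ ≤ ∑ j, ∫⁻ z, ENNReal.ofReal (max 0 (1 - 2 * (∑ i, (x j i - z i) ^ 2) / δ))
        ∂Measure.pi fun i ↦ gaussianReal (a i) V := Finset.sum_le_sum fun j _ ↦ hshift j
    _ = ∫⁻ z, ∑ j, ENNReal.ofReal (max 0 (1 - 2 * (∑ i, (x j i - z i) ^ 2) / δ))
        ∂Measure.pi fun i ↦ gaussianReal (a i) V :=
      (lintegral_finsetSum _ fun j _ ↦ by fun_prop).symm
    _ ≤ ∫⁻ _, 1 ∂Measure.pi fun i ↦ gaussianReal (a i) V := by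
      refine lintegral_mono fun z ↦ ?_
      simp only
      rw [← ENNReal.ofReal_sum_of_nonneg fun j _ ↦ le_max_left _ _]
      exact ENNReal.ofReal_le_one.mpr (sum_max_le_one hδ hsep z)
    _ = 1 := by simp

/-- Transfer of a risk bound from mean `m` to mean zero: Jensen applied to `exp (-X)` after a change
of measure, with a quadratic weight in the sum of the samples. -/
theorem ofReal_exp_le_lintegral_change_of_measure {ι : Type*} [Fintype ι] {N : ℕ} (hN : 0 < N)
    (m : ι → ℝ) {V : ℝ≥0} (hV : V ≠ 0) {X : (Fin N → ι → ℝ) → ℝ} (hX : Measurable X)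
    (hX0 : ∀ y, 0 ≤ X y) {B : ℝ} (hB : 0 ≤ B)
    (hXB : ∫⁻ y, ENNReal.ofReal (X y)
      ∂(Measure.pi fun _ : Fin N ↦ Measure.pi fun i ↦ gaussianReal (m i) V) ≤ ENNReal.ofReal B) :
    ENNReal.ofReal (Real.exp (-B + Fintype.card ι / 4 - N * (∑ i, m i ^ 2) / (4 * V))) ≤
      ∫⁻ y, ENNReal.ofReal (Real.exp (-X y)) *
          ENNReal.ofReal (Real.exp (∑ i, (∑ k, y k i) ^ 2 / (4 * (N * V))))
        ∂(Measure.pi fun _ : Fin N ↦ Measure.pi fun _ : ι ↦ gaussianReal 0 V) := by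
  have hN' : (N : ℝ) ≠ 0 := by exact_mod_cast hN.ne'
  have hV' : (V : ℝ) ≠ 0 := by exact_mod_cast hV
  set P := Measure.pi fun _ : Fin N ↦ Measure.pi fun i ↦ gaussianReal (m i) V with hP
  set μ := Measure.pi fun i ↦ gaussianReal (N * m i) (N * V) with hμ
  set h : ι → ℝ → ℝ := fun i s ↦
    s ^ 2 / (4 * (N * V)) - m i * s / V + N * m i ^ 2 / (2 * V) with hh
  have h_sq (i : ι) : Integrable (fun s : ℝ ↦ s ^ 2 / (4 * (N * V)))
      (gaussianReal (N * m i) (N * V)) := (integrable_sq_gaussianReal _ _).div_const _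
  have h_id (i : ι) : Integrable (fun s : ℝ ↦ m i * s / V) (gaussianReal (N * m i) (N * V)) :=
    (((memLp_id_gaussianReal 1).integrable le_rfl).const_mul _).div_const _
  have h_sub (i : ι) : Integrable (fun s : ℝ ↦ s ^ 2 / (4 * (N * V)) - m i * s / V)
      (gaussianReal (N * m i) (N * V)) := (h_sq i).sub (h_id i)
  have h_int (i : ι) : Integrable (h i) (gaussianReal (N * m i) (N * V)) :=
    (h_sub i).add (integrable_const _)
  have h_val (i : ι) : ∫ s, h i s ∂gaussianReal (N * m i) (N * V) =
      1 / 4 - N * m i ^ 2 / (4 * V) := by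
    simp only [hh]
    rw [integral_add (h_sub i) (integrable_const _),
      integral_sub (h_sq i) (h_id i), integral_div, integral_sq_gaussianReal, integral_div,
      integral_const_mul, integral_id_gaussianReal]
    simp only [integral_const, probReal_univ, one_smul]
    push_cast
    field_simp
    ring
  have hSm : Measurable fun y : Fin N → ι → ℝ ↦ ∑ k, y k := by fun_prop
  have hlaw : P.map (fun y ↦ ∑ k, y k) = μ := pi_pi_gaussianReal_map_sum N m V
  have hH_int : Integrable (fun s : ι → ℝ ↦ ∑ i, h i (s i)) μ :=
    integrable_finsetSum _ fun i _ ↦ integrable_comp_eval (h_int i)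
  have hS_int : Integrable (fun y : Fin N → ι → ℝ ↦ ∑ i, h i ((∑ k, y k) i)) P := by
    rw [← hlaw] at hH_int
    exact hH_int.comp_measurable hSm
  have hS_val : ∫ y : Fin N → ι → ℝ, ∑ i, h i ((∑ k, y k) i) ∂P =
      Fintype.card ι / 4 - N * (∑ i, m i ^ 2) / (4 * V) := by
    have h1 := integral_map (μ := P) hSm.aemeasurable
      (f := fun s : ι → ℝ ↦ ∑ i, h i (s i)) (by rw [hlaw]; exact hH_int.1)
    rw [← h1, hlaw, integral_finsetSum _ fun i _ ↦ integrable_comp_eval (h_int i)]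
    have h2 (i : ι) : ∫ s, h i (s i) ∂μ = 1 / 4 - N * m i ^ 2 / (4 * V) := by
      rw [hμ, integral_comp_eval (h_int i).1, h_val]
    rw [Finset.sum_congr rfl fun i _ ↦ h2 i]
    rw [Finset.sum_sub_distrib, Finset.mul_sum, Finset.sum_div]
    simp [div_eq_mul_inv]
  have hX_int : Integrable X P := ⟨hX.aestronglyMeasurable, by
    rw [hasFiniteIntegral_iff_ofReal (.of_forall hX0)]
    exact hXB.trans_lt ENNReal.ofReal_lt_top⟩
  have hX_neg : Integrable (fun y ↦ -X y) P := hX_int.neg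
  have hX_val : ∫ y, X y ∂P ≤ B := by
    rw [← ofReal_integral_eq_lintegral_ofReal hX_int (.of_forall hX0)] at hXB
    exact (ENNReal.ofReal_le_ofReal_iff hB).mp hXB
  calc _ ≤ ENNReal.ofReal (Real.exp (∫ y, (-X y + ∑ i, h i ((∑ k, y k) i)) ∂P)) := by
        refine ENNReal.ofReal_le_ofReal (Real.exp_le_exp.mpr ?_)
        rw [integral_add hX_neg hS_int, integral_neg, hS_val]
        linarith
    _ ≤ ∫⁻ y, ENNReal.ofReal (Real.exp (-X y + ∑ i, h i ((∑ k, y k) i))) ∂P :=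
        ofReal_exp_integral_le_lintegral (hX_neg.add hS_int)
    _ = _ := by
        rw [hP, pi_pi_gaussianReal_eq_withDensity m hV,
          lintegral_withDensity_eq_lintegral_mul _ (by fun_prop) (by fun_prop)]
        refine lintegral_congr fun y ↦ ?_
        simp only [Pi.mul_apply]
        rw [← ENNReal.ofReal_mul (Real.exp_pos _).le, ← ENNReal.ofReal_mul (Real.exp_pos _).le,
          ← Real.exp_add, ← Real.exp_add]
        congr 2
        rw [Finset.sum_comm, add_left_comm, ← Finset.sum_add_distrib]
        congr 1
        refine Finset.sum_congr rfl fun i _ ↦ ?_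
        simp only [hh, Finset.sum_apply, Finset.sum_sub_distrib, Finset.sum_const, Finset.card_univ,
          Fintype.card_fin, nsmul_eq_mul]
        rw [← Finset.sum_div, ← Finset.mul_sum]
        ring

theorem lintegral_exp_sum_sq_pi_pi_gaussianReal {ι : Type*} [Fintype ι] {N : ℕ} (hN : 0 < N)
    {V : ℝ≥0} (hV : V ≠ 0) :
    ∫⁻ y, ENNReal.ofReal (Real.exp (∑ i, (∑ k, y k i) ^ 2 / (4 * (N * V))))
        ∂(Measure.pi fun _ : Fin N ↦ Measure.pi fun _ : ι ↦ gaussianReal 0 V) =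
      ENNReal.ofReal (Real.sqrt 2 ^ Fintype.card ι) := by
  have hT : (N : ℝ≥0) * V ≠ 0 := mul_ne_zero (by exact_mod_cast hN.ne') hV
  have hlaw := pi_pi_gaussianReal_map_sum N (fun _ : ι ↦ 0) V
  simp only [mul_zero] at hlaw
  have h := lintegral_map
    (μ := Measure.pi fun _ : Fin N ↦ Measure.pi fun _ : ι ↦ gaussianReal 0 V)
    (f := fun s : ι → ℝ ↦ ENNReal.ofReal (Real.exp (∑ i, s i ^ 2 / (4 * (N * V)))))
    (g := fun y ↦ ∑ k, y k) (by fun_prop) (by fun_prop)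
  simp only [Finset.sum_apply] at h
  rw [← h, hlaw]
  simp_rw [Real.exp_sum, ENNReal.ofReal_prod_of_nonneg fun i _ ↦ (Real.exp_pos _).le]
  rw [lintegral_pi_prod (f := fun _ s ↦ ENNReal.ofReal (Real.exp (s ^ 2 / (4 * (N * V)))))
    fun i ↦ by fun_prop]
  have h1 := lintegral_exp_sq_gaussianReal hT
  push_cast at h1
  rw [h1, Finset.prod_const, Finset.card_univ, ENNReal.ofReal_pow (Real.sqrt_nonneg _)]

/-- **Fano lower bound, noise-dominated regime** (Proposition).
The unknown mean lies in the set `{√(dσ²/N)·v^(j)}` built from a `c(d)`-separated packing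
of unit vectors with zero first coordinate, `K ≥ 4e^d`; samples are `N` i.i.d. draws from
`N(θ, σ'²·I_d)` with `σ'² ≥ σ²`.  Every measurable estimator has worst-case risk at least
`(c²(d)/2)·(dσ²/N)`. -/
theorem fano_lower_noise_regime (d N : ℕ) (hd : 3 ≤ d) (hN : 0 < N)
    (σ σ' : ℝ) (hσ : 0 < σ) (hσ' : σ ^ 2 ≤ σ' ^ 2)
    (K : ℕ) (v : Fin K → Fin d → ℝ)
    (hunit : ∀ j, ∑ i, v j i ^ 2 = 1)
    (hfirst : ∀ j, v j ⟨0, by omega⟩ = 0)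
    (hsep : ∀ j₁ j₂, j₁ ≠ j₂ →
      Real.exp (-((d : ℝ) + 2) / ((d : ℝ) - 2)) ≤ Real.sqrt (sqDist (v j₁) (v j₂)))
    (hK : 4 * Real.exp d ≤ (K : ℝ))
    (θhat : (Fin N → Fin d → ℝ) → Fin d → ℝ) (hmeas : Measurable θhat) :
    ENNReal.ofReal (Real.exp (-((d : ℝ) + 2) / ((d : ℝ) - 2)) ^ 2 / 2 * (d * σ ^ 2 / N)) ≤
      ⨆ j : Fin K,
        ∫⁻ y, ENNReal.ofReal
            (sqDist (θhat y) (fun i => Real.sqrt (d * σ ^ 2 / N) * v j i))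
          ∂(Measure.pi fun _ : Fin N => Measure.pi fun i : Fin d =>
              gaussianReal (Real.sqrt (d * σ ^ 2 / N) * v j i) ((σ' ^ 2).toNNReal)) := by
  set c := Real.exp (-((d : ℝ) + 2) / ((d : ℝ) - 2)) with hc
  have hc0 : 0 < c := Real.exp_pos _
  set r := Real.sqrt (d * σ ^ 2 / N) with hr
  have hd0 : (0 : ℝ) < d := by exact_mod_cast (by omega : 0 < d)
  have hN0 : (0 : ℝ) < N := by exact_mod_cast hN
  have hr2 : r ^ 2 = d * σ ^ 2 / N := Real.sq_sqrt (by positivity)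
  have hr0 : 0 < r := Real.sqrt_pos.mpr (by positivity)
  have hσ'0 : 0 < σ' ^ 2 := lt_of_lt_of_le (by positivity) hσ'
  set V := (σ' ^ 2).toNNReal with hVdef
  have hVr : (V : ℝ) = σ' ^ 2 := Real.coe_toNNReal _ hσ'0.le
  have hV : V ≠ 0 := (Real.toNNReal_pos.mpr hσ'0).ne'
  let i₀ : Fin d := ⟨0, by omega⟩
  have hcard : (Fintype.card {i : Fin d // i ≠ i₀} : ℝ) = d - 1 := by
    rw [Fintype.card_subtype_compl, Fintype.card_fin, Fintype.card_subtype_eq,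
      Nat.cast_sub (by omega), Nat.cast_one]
  have hd3 : (3 : ℝ) ≤ d := by exact_mod_cast hd
  have hn0 : (0 : ℝ) < d - 1 := by linarith
  have hsum (f : Fin d → ℝ) : ∑ i, f i = f i₀ + ∑ i : {i : Fin d // i ≠ i₀}, f i := by
    rw [← Finset.add_sum_erase _ f (Finset.mem_univ i₀)]
    congr 1
    exact Finset.sum_subtype _ (by simp) f
  -- The variance of the kernel is tuned so that `2 (d - 1) W / c ^ 2 = 4 / 5`.
  set W := (2 * c ^ 2 / (5 * (d - 1))).toNNReal with hWdef
  have hW0 : 0 < 2 * c ^ 2 / (5 * ((d : ℝ) - 1)) := by positivity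
  have hWr : (W : ℝ) = 2 * c ^ 2 / (5 * (d - 1)) := Real.coe_toNNReal _ hW0.le
  have hW : W ≠ 0 := (Real.toNNReal_pos.mpr hW0).ne'
  have hW' : (0 : ℝ) < W := hWr ▸ hW0
  set X : Fin K → (Fin N → Fin d → ℝ) → ℝ := fun j y ↦
    (∑ i : {i : Fin d // i ≠ i₀}, (v j i - θhat y i / r) ^ 2) / (2 * W) with hX
  have hXm (j : Fin K) : Measurable (X j) := by fun_prop
  have hX0 (j : Fin K) (y) : 0 ≤ X j y := by positivity
  have hXle (j : Fin K) (y) :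
      X j y ≤ 1 / (2 * W * r ^ 2) * sqDist (θhat y) (fun i ↦ r * v j i) := by
    have h1 : sqDist (θhat y) (fun i ↦ r * v j i) = r ^ 2 * ∑ i, (v j i - θhat y i / r) ^ 2 := by
      rw [sqDist, Finset.mul_sum]
      refine Finset.sum_congr rfl fun i _ ↦ ?_
      field_simp
      ring
    have h2 : 1 / (2 * W * r ^ 2) * (r ^ 2 * ∑ i, (v j i - θhat y i / r) ^ 2) =
        (∑ i, (v j i - θhat y i / r) ^ 2) / (2 * W) := by
      field_simp
    rw [h1, h2, hsum fun i ↦ (v j i - θhat y i / r) ^ 2]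
    simp only [hX]
    gcongr
    exact le_add_of_nonneg_left (sq_nonneg _)
  have hXsum (y) : (∑ j, ENNReal.ofReal (Real.exp (-X j y))) * ENNReal.ofReal (1 / 5) ≤ 1 := by
    have hsep' (j k : Fin K) (hjk : j ≠ k) :
        c ^ 2 ≤ ∑ i : {i : Fin d // i ≠ i₀}, (v j i - v k i) ^ 2 := by
      have h1 := (Real.le_sqrt' hc0).mp (hsep j k hjk)
      rw [sqDist, hsum fun i ↦ (v j i - v k i) ^ 2, hfirst j, hfirst k] at h1
      simpa using h1
    have h := sum_ofReal_exp_mul_le_one (x := fun j (i : {i : Fin d // i ≠ i₀}) ↦ v j i)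
      (pow_pos hc0 2) hsep' hW (fun i ↦ θhat y i / r)
    have h5 : 1 - 2 * ((Fintype.card {i : Fin d // i ≠ i₀} : ℝ) * W) / c ^ 2 = 1 / 5 := by
      rw [hcard, hWr]
      field_simp
      ring
    rw [h5] at h
    simpa only [hX, neg_div] using h
  by_contra! hlt
  have hrisk (j : Fin K) : ∫⁻ y, ENNReal.ofReal (X j y)
      ∂(Measure.pi fun _ : Fin N ↦ Measure.pi fun i ↦ gaussianReal (r * v j i) V) ≤
      ENNReal.ofReal (5 * (d - 1) / 8) := by
    have h1 := (le_iSup (fun j : Fin K ↦ ∫⁻ y, ENNReal.ofReal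
      (sqDist (θhat y) (fun i => r * v j i)) ∂(Measure.pi fun _ : Fin N => Measure.pi
        fun i : Fin d => gaussianReal (r * v j i) V)) j).trans hlt.le
    calc _ ≤ ∫⁻ y, ENNReal.ofReal (1 / (2 * W * r ^ 2)) * ENNReal.ofReal
          (sqDist (θhat y) (fun i ↦ r * v j i))
            ∂(Measure.pi fun _ : Fin N ↦ Measure.pi fun i ↦ gaussianReal (r * v j i) V) := by
          refine lintegral_mono fun y ↦ ?_
          rw [← ENNReal.ofReal_mul (by positivity)]
          exact ENNReal.ofReal_le_ofReal (hXle j y)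
      _ ≤ ENNReal.ofReal (1 / (2 * W * r ^ 2)) *
          ENNReal.ofReal (c ^ 2 / 2 * (d * σ ^ 2 / N)) := by
          rw [lintegral_const_mul' _ _ ENNReal.ofReal_ne_top]
          gcongr
      _ = _ := by
          rw [← ENNReal.ofReal_mul (by positivity), ← hr2, hWr]
          congr 1
          field_simp
          ring
  set E := Real.exp (-(5 * (d - 1) / 8) + d / 4 - d / 4) with hE
  have hjensen (j : Fin K) := ofReal_exp_le_lintegral_change_of_measure hN (fun i ↦ r * v j i) hV
    (hXm j) (hX0 j) (by positivity : (0 : ℝ) ≤ 5 * (d - 1) / 8) (hrisk j)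
  have hElow (j : Fin K) : ENNReal.ofReal E ≤
      ∫⁻ y, ENNReal.ofReal (Real.exp (-X j y)) *
          ENNReal.ofReal (Real.exp (∑ i, (∑ k, y k i) ^ 2 / (4 * (N * V))))
        ∂(Measure.pi fun _ : Fin N ↦ Measure.pi fun _ : Fin d ↦ gaussianReal 0 V) := by
    refine le_trans (ENNReal.ofReal_le_ofReal (Real.exp_le_exp.mpr ?_)) (hjensen j)
    have h1 : N * (∑ i, (r * v j i) ^ 2) / (4 * V) ≤ d / 4 := by
      simp_rw [mul_pow, ← Finset.mul_sum, hunit, hr2, hVr]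
      rw [div_le_div_iff₀ (by positivity) (by norm_num)]
      have : N * (d * σ ^ 2 / N * 1) = d * σ ^ 2 := by field_simp
      rw [this]
      nlinarith
    rw [Fintype.card_fin]
    linarith
  have htotal : (K : ℝ≥0∞) * ENNReal.ofReal E * ENNReal.ofReal (1 / 5) ≤
      ENNReal.ofReal (Real.sqrt 2 ^ d) := by
    have hgauss := lintegral_exp_sum_sq_pi_pi_gaussianReal (ι := Fin d) hN hV
    rw [Fintype.card_fin] at hgauss
    calc _ = (∑ _j : Fin K, ENNReal.ofReal E) * ENNReal.ofReal (1 / 5) := by simp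
      _ ≤ (∑ j, ∫⁻ y, ENNReal.ofReal (Real.exp (-X j y)) *
          ENNReal.ofReal (Real.exp (∑ i, (∑ k, y k i) ^ 2 / (4 * (N * V))))
        ∂(Measure.pi fun _ : Fin N ↦ Measure.pi fun _ : Fin d ↦ gaussianReal 0 V)) *
          ENNReal.ofReal (1 / 5) := by gcongr with j; exact hElow j
      _ = ∫⁻ y, (∑ j, ENNReal.ofReal (Real.exp (-X j y))) * ENNReal.ofReal (1 / 5) *
          ENNReal.ofReal (Real.exp (∑ i, (∑ k, y k i) ^ 2 / (4 * (N * V))))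
        ∂(Measure.pi fun _ : Fin N ↦ Measure.pi fun _ : Fin d ↦ gaussianReal 0 V) := by
          rw [← lintegral_finsetSum _ fun j _ ↦ by fun_prop,
            ← lintegral_mul_const' _ _ ENNReal.ofReal_ne_top]
          refine lintegral_congr fun y ↦ ?_
          rw [← Finset.sum_mul, mul_right_comm]
      _ ≤ ∫⁻ y, ENNReal.ofReal (Real.exp (∑ i, (∑ k, y k i) ^ 2 / (4 * (N * V))))
        ∂(Measure.pi fun _ : Fin N ↦ Measure.pi fun _ : Fin d ↦ gaussianReal 0 V) :=
          lintegral_mono fun y ↦ mul_le_of_le_one_left' (hXsum y)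
      _ = _ := hgauss
  have hreal : K * E * (1 / 5) ≤ Real.sqrt 2 ^ d := by
    rw [← ENNReal.ofReal_natCast, ← ENNReal.ofReal_mul (by positivity),
      ← ENNReal.ofReal_mul (by positivity)] at htotal
    exact (ENNReal.ofReal_le_ofReal_iff (by positivity)).mp htotal
  have hsqrt : Real.sqrt 2 ^ d ≤ Real.exp (7 / 20 * d) := by
    rw [mul_comm, Real.exp_nat_mul]
    refine pow_le_pow_left₀ (Real.sqrt_nonneg _) ?_ _
    rw [Real.sqrt_le_left (Real.exp_pos _).le, ← Real.exp_nat_mul,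
      ← Real.log_le_iff_le_exp (by norm_num)]
    have := Real.log_two_lt_d9
    norm_num at this ⊢
    linarith
  have hgrow : Real.exp d * E = Real.exp (7 / 20 * d) * Real.exp (d / 40 + 5 / 8) := by
    rw [hE, ← Real.exp_add, ← Real.exp_add]
    congr 1
    ring
  have hexp : 1 + 5 / 8 ≤ Real.exp ((d : ℝ) / 40 + 5 / 8) := by
    have := Real.add_one_le_exp ((d : ℝ) / 40 + 5 / 8)
    linarith
  have hK' : 4 * (Real.exp d * E) ≤ K * E := by
    rw [← mul_assoc]
    exact mul_le_mul_of_nonneg_right hK (Real.exp_pos _).le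
  rw [hgrow] at hK'
  nlinarith [Real.exp_pos (7 / 20 * (d : ℝ))]
end

section
/- Assume d ≥ 3, let σ₀ > 0 and q > 0 with q² ≤ d·σ₀²/N, and let {v^(1), …, v^(K)} ⊂ ℝ^d be a set of unit vectors with zero first coordinate, pairwise Euclidean distances at least c(d) = e^{−(d+2)/(d−2)}, and cardinality K ≥ 4·e^d. Define the parameter set Θ := { q·v^(j) : j ∈ [K] }. Then for every estimator θ̂ that is a measurable function of N i.i.d. samples from N(θ, σ₀²·I_d), the worst case over θ ∈ Θ of E[‖θ̂ − θ‖²] is at least (c²(d)/8)·q². -/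
open MeasureTheory ProbabilityTheory

/-- `HasNegLogDensity P Q L k` says that `Q` has density `exp (-L)` with respect to `P` and that
`L` has `P`-mean `k`; so `k` is the Kullback–Leibler divergence of `P` from `Q`. -/
structure HasNegLogDensity {α : Type*} [MeasurableSpace α] (P Q : Measure α) (L : α → ℝ)
    (k : ℝ) : Prop where
  measurable : Measurable L
  eq_withDensity : Q = P.withDensity fun x => ENNReal.ofReal (Real.exp (-L x))
  integrable : Integrable L P
  integral_eq : ∫ x, L x ∂P = k

lemma lintegral_pi_prod_eq {ι : Type*} [Fintype ι] {α : ι → Type*} [∀ i, MeasurableSpace (α i)]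
    (P : ∀ i, Measure (α i)) [∀ i, IsProbabilityMeasure (P i)] (f : ∀ i, α i → ENNReal)
    (hf : ∀ i, Measurable (f i)) :
    ∫⁻ x, ∏ i, f i (x i) ∂Measure.pi P = ∏ i, ∫⁻ x, f i x ∂P i := by
  refine (lintegral_prod_eq_prod_lintegral_of_indepFun Finset.univ
    (fun i (x : ∀ i, α i) => f i (x i)) (iIndepFun_pi fun i => (hf i).aemeasurable)
    fun i => (hf i).comp (measurable_pi_apply i)).trans ?_
  refine Finset.prod_congr rfl fun i _ => ?_
  exact (measurePreserving_eval P i).lintegral_comp (hf i)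

lemma HasNegLogDensity.pi {ι : Type*} [Fintype ι] {α : ι → Type*} [∀ i, MeasurableSpace (α i)]
    {P Q : ∀ i, Measure (α i)} [∀ i, IsProbabilityMeasure (P i)]
    [∀ i, IsProbabilityMeasure (Q i)] {L : ∀ i, α i → ℝ} {k : ι → ℝ}
    (h : ∀ i, HasNegLogDensity (P i) (Q i) (L i) (k i)) :
    HasNegLogDensity (Measure.pi P) (Measure.pi Q) (fun x => ∑ i, L i (x i)) (∑ i, k i) where
  measurable := Finset.measurable_sum _ fun i _ => (h i).measurable.comp (measurable_pi_apply i)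
  eq_withDensity := by
    classical
    refine Measure.pi_eq fun s hs => ?_
    have hm : ∀ i, Measurable fun x => ENNReal.ofReal (Real.exp (-L i x)) := fun i =>
      ((h i).measurable.neg.exp).ennreal_ofReal
    have hQ : ∀ i, Q i (s i) =
        ∫⁻ x, (s i).indicator (fun x => ENNReal.ofReal (Real.exp (-L i x))) x ∂P i := by
      intro i
      rw [lintegral_indicator (hs i)]
      conv_lhs => rw [(h i).eq_withDensity]
      rw [withDensity_apply _ (hs i)]
    simp_rw [hQ]
    rw [← lintegral_pi_prod_eq P _ fun i => (hm i).indicator (hs i),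
      withDensity_apply _ (MeasurableSet.univ_pi hs),
      ← lintegral_indicator (MeasurableSet.univ_pi hs)]
    refine lintegral_congr fun x => ?_
    by_cases hx : x ∈ Set.univ.pi s
    · rw [Set.indicator_of_mem hx, ← Finset.sum_neg_distrib, Real.exp_sum,
        ENNReal.ofReal_prod_of_nonneg fun i _ => (Real.exp_pos _).le]
      exact Finset.prod_congr rfl fun i _ => by
        rw [Set.indicator_of_mem (hx i (Set.mem_univ i))]
    · rw [Set.indicator_of_notMem hx]
      obtain ⟨i, hi⟩ : ∃ i, x i ∉ s i := by simpa [Set.mem_pi] using hx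
      exact (Finset.prod_eq_zero (Finset.mem_univ i) (Set.indicator_of_notMem hi _)).symm
  integrable := integrable_finsetSum _ fun i _ => integrable_comp_eval (h i).integrable
  integral_eq := by
    rw [integral_finsetSum _ fun i _ => integrable_comp_eval (h i).integrable]
    refine Finset.sum_congr rfl fun i _ => ?_
    rw [integral_comp_eval (h i).integrable.aestronglyMeasurable, (h i).integral_eq]

lemma hasNegLogDensity_gaussianReal (m : ℝ) {v : NNReal} (hv : v ≠ 0) :
    HasNegLogDensity (gaussianReal m v) (gaussianReal 0 v)
      (fun x => m / v * x - m ^ 2 / (2 * v)) (m ^ 2 / (2 * v)) where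
  measurable := by fun_prop
  eq_withDensity := by
    have hv' : (v : ℝ) ≠ 0 := by exact_mod_cast hv
    rw [gaussianReal_of_var_ne_zero _ hv, gaussianReal_of_var_ne_zero _ hv,
      ← withDensity_mul _ (measurable_gaussianPDF _ _) (by fun_prop)]
    congr 1
    ext x
    rw [Pi.mul_apply, gaussianPDF, gaussianPDF,
      ← ENNReal.ofReal_mul (gaussianPDFReal_nonneg _ _ _), gaussianPDFReal, gaussianPDFReal,
      mul_assoc _ (Real.exp _), ← Real.exp_add]
    congr 3
    field_simp
    ring
  integrable := by
    have h : Integrable (fun x : ℝ => x) (gaussianReal m v) :=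
      memLp_one_iff_integrable.1 (memLp_id_gaussianReal 1)
    exact (h.const_mul _).sub (integrable_const _)
  integral_eq := by
    have hv' : (v : ℝ) ≠ 0 := by exact_mod_cast hv
    have h : Integrable (fun x : ℝ => x) (gaussianReal m v) :=
      memLp_one_iff_integrable.1 (memLp_id_gaussianReal 1)
    rw [integral_sub (h.const_mul _) (integrable_const _), integral_const_mul,
      integral_id_gaussianReal, integral_const]
    simp only [probReal_univ, smul_eq_mul, one_mul]
    field_simp
    ring

/-- A linearized Donsker–Varadhan inequality for the indicator of an event. -/
lemma HasNegLogDensity.two_mul_le {α : Type*} [MeasurableSpace α] {P Q : Measure α}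
    [IsProbabilityMeasure P] [IsProbabilityMeasure Q] {L : α → ℝ} {k : ℝ}
    (h : HasNegLogDensity P Q L k) {A : Set α} (hA : MeasurableSet A) (t : ℝ) :
    2 * (1 + t * P.real A - k - Real.log 2) ≤ 1 + (Real.exp t - 1) * Q.real A := by
  have hind : ∀ R : Measure α, IsProbabilityMeasure R →
      Integrable (A.indicator fun _ => (1 : ℝ)) R := fun R _ =>
    (integrable_const _).indicator hA
  have hd : Measurable fun x => ENNReal.ofReal (Real.exp (-L x)) :=
    h.measurable.neg.exp.ennreal_ofReal
  have hlt : ∀ᵐ x ∂P, ENNReal.ofReal (Real.exp (-L x)) < ⊤ :=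
    ae_of_all _ fun _ => ENNReal.ofReal_lt_top
  let g : α → ℝ := fun x => 1 + (Real.exp t - 1) * A.indicator (fun _ => (1 : ℝ)) x
  have hgQ : Integrable g Q := (integrable_const _).add ((hind Q inferInstance).const_mul _)
  have hg : ∫ x, g x ∂Q = 1 + (Real.exp t - 1) * Q.real A := by
    rw [integral_add (integrable_const _) ((hind Q inferInstance).const_mul _),
      integral_const_mul, integral_indicator_const _ hA]
    simp
  let f : α → ℝ := fun x =>
    2 * ((1 - Real.log 2) + t * A.indicator (fun _ => (1 : ℝ)) x - L x)
  have hf₁ : Integrable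
      (fun x => (1 - Real.log 2) + t * A.indicator (fun _ => (1 : ℝ)) x) P :=
    (integrable_const _).add ((hind P inferInstance).const_mul _)
  have hf : ∫ x, f x ∂P = 2 * (1 + t * P.real A - k - Real.log 2) := by
    rw [integral_const_mul, integral_sub hf₁ h.integrable,
      integral_add (integrable_const _) ((hind P inferInstance).const_mul _),
      integral_const_mul, integral_indicator_const _ hA, h.integral_eq]
    simp
    ring
  have hgP : ∫ x, g x ∂Q = ∫ x, Real.exp (-L x) * g x ∂P := by
    conv_lhs => rw [h.eq_withDensity]
    rw [integral_withDensity_eq_integral_toReal_smul hd hlt]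
    simp [ENNReal.toReal_ofReal, (Real.exp_pos _).le]
  have hgi : Integrable (fun x => Real.exp (-L x) * g x) P := by
    rw [h.eq_withDensity, integrable_withDensity_iff_integrable_smul' hd hlt] at hgQ
    simpa [ENNReal.toReal_ofReal, (Real.exp_pos _).le] using hgQ
  rw [← hf, ← hg, hgP]
  refine integral_mono ((hf₁.sub h.integrable).const_mul 2) hgi fun x => ?_
  have hgx : g x = Real.exp (t * A.indicator (fun _ => (1 : ℝ)) x) := by
    by_cases hx : x ∈ A <;> simp [g, hx]
  have key := Real.add_one_le_exp
    (-L x + t * A.indicator (fun _ => (1 : ℝ)) x - Real.log 2)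
  rw [Real.exp_sub, Real.exp_log two_pos, Real.exp_add] at key
  change f x ≤ Real.exp (-L x) * g x
  rw [hgx]
  simp only [f]
  linarith

/-- Fano's inequality: if the decoding events are disjoint and the divergences are small compared
with the log-cardinality, some hypothesis is decoded correctly with probability at most `1/2`. -/
lemma exists_measureReal_le_half {α : Type*} [MeasurableSpace α] {K : ℕ} (hK : 0 < K)
    {P : Fin K → Measure α} [∀ j, IsProbabilityMeasure (P j)] {Q : Measure α}
    [IsProbabilityMeasure Q] {L : Fin K → α → ℝ} {k : ℝ}
    (h : ∀ j, HasNegLogDensity (P j) Q (L j) k) {A : Fin K → Set α}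
    (hA : ∀ j, MeasurableSet (A j)) (hdisj : Pairwise fun i j => Disjoint (A i) (A j))
    (hk : 2 * (k + Real.log 2) ≤ Real.log K) :
    ∃ j, (P j).real (A j) ≤ 1 / 2 := by
  by_contra! hlt
  have hK1 : (1 : ℝ) ≤ K := by exact_mod_cast hK
  have hsumQ : ∑ j, Q.real (A j) ≤ 1 := by
    rw [← measureReal_iUnion_fintype hdisj hA]
    exact measureReal_le_one
  have hterm : ∀ j, 2 ≤ 1 + ((K : ℝ) - 1) * Q.real (A j) := by
    intro j
    have h1 := (h j).two_mul_le (hA j) (Real.log K)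
    rw [Real.exp_log (by linarith)] at h1
    have h2 := mul_le_mul_of_nonneg_left (hlt j).le (Real.log_nonneg hK1)
    linarith
  have hsum := Finset.sum_le_sum fun j (_ : j ∈ Finset.univ) => hterm j
  rw [Finset.sum_add_distrib, ← Finset.mul_sum] at hsum
  simp only [Finset.sum_const, Finset.card_univ, Fintype.card_fin, nsmul_eq_mul] at hsum
  have := mul_le_mul_of_nonneg_left hsumQ (sub_nonneg.2 hK1)
  linarith

lemma sqDist_le_two_mul_add {d : ℕ} (x a b : Fin d → ℝ) :
    sqDist a b ≤ 2 * (sqDist x a + sqDist x b) := by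
  simp only [sqDist]
  rw [← Finset.sum_add_distrib, Finset.mul_sum]
  exact Finset.sum_le_sum fun i _ => by nlinarith [sq_nonneg (2 * x i - a i - b i)]

lemma sqDist_mul_left {d : ℕ} (q : ℝ) (a b : Fin d → ℝ) :
    sqDist (fun i => q * a i) (fun i => q * b i) = q ^ 2 * sqDist a b := by
  simp only [sqDist, Finset.mul_sum]
  exact Finset.sum_congr rfl fun i _ => by ring

/-- **Fano lower bound, similarity-dominated regime** (Proposition).
The unknown mean lies in the set `{q·v^(j)}` built from a `c(d)`-separated packing of unit
vectors with zero first coordinate, `K ≥ 4e^d`, where `q² ≤ dσ₀²/N`; samples are `N`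
i.i.d. draws from `N(θ, σ₀²·I_d)`.  Every measurable estimator has worst-case risk at
least `(c²(d)/8)·q²`. -/
theorem fano_lower_similarity_regime (d N : ℕ) (hd : 3 ≤ d) (hN : 0 < N)
    (σ0 q : ℝ) (hσ0 : 0 < σ0) (hq : 0 < q) (hqσ : q ^ 2 ≤ d * σ0 ^ 2 / N)
    (K : ℕ) (v : Fin K → Fin d → ℝ)
    (hunit : ∀ j, ∑ i, v j i ^ 2 = 1)
    (hfirst : ∀ j, v j ⟨0, by omega⟩ = 0)
    (hsep : ∀ j₁ j₂, j₁ ≠ j₂ →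
      Real.exp (-((d : ℝ) + 2) / ((d : ℝ) - 2)) ≤ Real.sqrt (sqDist (v j₁) (v j₂)))
    (hK : 4 * Real.exp d ≤ (K : ℝ))
    (θhat : (Fin N → Fin d → ℝ) → Fin d → ℝ) (hmeas : Measurable θhat) :
    ENNReal.ofReal (Real.exp (-((d : ℝ) + 2) / ((d : ℝ) - 2)) ^ 2 / 8 * q ^ 2) ≤
      ⨆ j : Fin K,
        ∫⁻ y, ENNReal.ofReal (sqDist (θhat y) (fun i => q * v j i))
          ∂(Measure.pi fun _ : Fin N => Measure.pi fun i : Fin d =>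
              gaussianReal (q * v j i) ((σ0 ^ 2).toNNReal)) := by
  set c := Real.exp (-((d : ℝ) + 2) / ((d : ℝ) - 2)) with hc
  have hc0 : 0 < c := Real.exp_pos _
  have hv : (σ0 ^ 2).toNNReal ≠ 0 := by simp [Real.toNNReal_eq_zero, hσ0.ne']
  have hv' : (((σ0 ^ 2).toNNReal : NNReal) : ℝ) = σ0 ^ 2 := Real.coe_toNNReal _ (sq_nonneg _)
  have hN' : (0 : ℝ) < N := by exact_mod_cast hN
  have hK0 : (0 : ℝ) < K := lt_of_lt_of_le (by positivity) hK
  let P : Fin K → Measure (Fin N → Fin d → ℝ) := fun j =>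
    Measure.pi fun _ : Fin N => Measure.pi fun i : Fin d =>
      gaussianReal (q * v j i) ((σ0 ^ 2).toNNReal)
  let Q : Measure (Fin N → Fin d → ℝ) :=
    Measure.pi fun _ : Fin N => Measure.pi fun _ : Fin d => gaussianReal 0 ((σ0 ^ 2).toNNReal)
  have : ∀ j, IsProbabilityMeasure (P j) := fun j => by dsimp only [P]; infer_instance
  have : IsProbabilityMeasure Q := by dsimp only [Q]; infer_instance
  have hdens : ∀ j, ∃ L, HasNegLogDensity (P j) Q L (N * (q ^ 2 / (2 * σ0 ^ 2))) := by
    intro j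
    have h := HasNegLogDensity.pi fun _ : Fin N => HasNegLogDensity.pi fun i : Fin d =>
      hasNegLogDensity_gaussianReal (q * v j i) hv
    refine ⟨_, h.measurable, h.eq_withDensity, h.integrable, h.integral_eq.trans ?_⟩
    simp only [Finset.sum_const, Finset.card_univ, Fintype.card_fin, nsmul_eq_mul, hv', mul_pow,
      ← Finset.sum_div, ← Finset.mul_sum, hunit j, mul_one]
  choose L hL using hdens
  have hrisk : ∀ j, Measurable fun y => sqDist (θhat y) (fun i => q * v j i) := by
    intro j
    unfold sqDist
    fun_prop
  obtain ⟨j, hj⟩ := exists_measureReal_le_half (by exact_mod_cast hK0) hL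
    (A := fun j => {y | sqDist (θhat y) (fun i => q * v j i) < c ^ 2 * q ^ 2 / 4})
    (fun j => measurableSet_lt (hrisk j) measurable_const)
    (by
      intro i j hij
      refine Set.disjoint_left.2 fun y hyi hyj => ?_
      simp only [Set.mem_ofPred_eq] at hyi hyj
      have h1 := sqDist_le_two_mul_add (θhat y) (fun l => q * v i l) (fun l => q * v j l)
      rw [sqDist_mul_left] at h1
      have h2 := mul_le_mul_of_nonneg_left ((Real.le_sqrt' hc0).1 (hsep i j hij)) (sq_nonneg q)
      linarith)
    (by
      have h1 : Real.log (4 * Real.exp d) ≤ Real.log K := Real.log_le_log (by positivity) hK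
      have h4 : Real.log 4 = 2 * Real.log 2 := by
        rw [show (4 : ℝ) = 2 ^ 2 by norm_num, Real.log_pow]
        norm_num
      rw [Real.log_mul (by norm_num) (Real.exp_pos _).ne', Real.log_exp, h4] at h1
      have h2 : (N : ℝ) * (q ^ 2 / (2 * σ0 ^ 2)) ≤ d / 2 := by
        rw [le_div_iff₀ hN'] at hqσ
        rw [← mul_div_assoc, div_le_div_iff₀ (by positivity) two_pos]
        linarith
      linarith)
  refine le_trans ?_ (le_iSup _ j)
  set A : Set (Fin N → Fin d → ℝ) :=
    {y | sqDist (θhat y) (fun i => q * v j i) < c ^ 2 * q ^ 2 / 4}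
  have hA : MeasurableSet A := measurableSet_lt (hrisk j) measurable_const
  have hcompl : ENNReal.ofReal (1 / 2) ≤ P j Aᶜ := by
    rw [← ofReal_measureReal, probReal_compl_eq_one_sub hA]
    exact ENNReal.ofReal_le_ofReal (by linarith)
  calc ENNReal.ofReal (c ^ 2 / 8 * q ^ 2)
      = ENNReal.ofReal (c ^ 2 * q ^ 2 / 4) * ENNReal.ofReal (1 / 2) := by
        rw [← ENNReal.ofReal_mul (by positivity)]
        congr 1
        ring
    _ ≤ ENNReal.ofReal (c ^ 2 * q ^ 2 / 4) * P j Aᶜ := by gcongr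
    _ ≤ ENNReal.ofReal (c ^ 2 * q ^ 2 / 4) * P j {y | ENNReal.ofReal (c ^ 2 * q ^ 2 / 4) ≤
          ENNReal.ofReal (sqDist (θhat y) (fun i => q * v j i))} := by
        gcongr
        intro y hy
        exact ENNReal.ofReal_le_ofReal (not_lt.1 hy)
    _ ≤ _ := mul_meas_ge_le_lintegral (hrisk j).ennreal_ofReal _
end
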